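/- arXiv:2412.11195 — 2 statements merged into one kernel-verified Lean document; each statement's English description precedes it below -/
import Mathlib

section
/- Let k ≥ 2 be an integer and let G be a simple graph on n vertices. Suppose there exist a vertex v of G and an integer ℓ with 1 ≤ ℓ ≤ k−1 such that the sum of the degrees deg(u) over all vertices u in R_ℓ(v) is strictly greater than 6·(2k)^ℓ·n. Then G contains a cycle of length 2k. -/
open scoped Classical

/-- A simple graph `G` contains a cycle of length `m`: there exist `m` pairwise
distinct vertices `v₀, …, v_{m-1}` such that `vᵢ` is adjacent to `v_{i+1}`,
indices taken modulo `m`. -/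
def SimpleGraph.HasCycleOfLength {V : Type*} (G : SimpleGraph V) (m : ℕ) : Prop :=
  ∃ f : ZMod m → V, Function.Injective f ∧ ∀ i : ZMod m, G.Adj (f i) (f (i + 1))

theorem hasCycle_of_nat {V : Type*} (G : SimpleGraph V) (m : ℕ) (hm : 2 ≤ m) (h : ℕ → V)
    (hinj : ∀ i j, i < j → j < m → h i ≠ h j)
    (hadj : ∀ i, i + 1 < m → G.Adj (h i) (h (i + 1)))
    (hlast : G.Adj (h (m - 1)) (h 0)) : G.HasCycleOfLength m := by
  haveI : NeZero m := ⟨by omega⟩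
  haveI : Fact (1 < m) := ⟨by omega⟩
  refine ⟨fun z => h z.val, ?_, ?_⟩
  · intro a b hab
    apply ZMod.val_injective
    have ha := ZMod.val_lt a
    have hb := ZMod.val_lt b
    rcases lt_trichotomy a.val b.val with h1 | h1 | h1
    · exact absurd hab (hinj _ _ h1 hb)
    · exact h1
    · exact absurd hab.symm (hinj _ _ h1 ha)
  · intro i
    have hi := ZMod.val_lt i
    have h1 : (i + 1).val = (i.val + 1) % m := by
      rw [ZMod.val_add, ZMod.val_one]
    show G.Adj (h i.val) (h (i + 1).val)
    rw [h1]
    by_cases hc : i.val + 1 < m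
    · rw [Nat.mod_eq_of_lt hc]; exact hadj _ hc
    · have : i.val = m - 1 := by omega
      have h2 : i.val + 1 = m := by omega
      rw [h2, Nat.mod_self, this]; exact hlast

theorem good_iter {V : Type*} (Good : ℕ → V → Prop) (par : V → V)
    (hpar : ∀ i x, Good (i + 1) x → Good i (par x)) (ℓ : ℕ) (x : V) (hx : Good ℓ x) :
    ∀ e, e ≤ ℓ → Good (ℓ - e) (par^[e] x) := by
  intro e
  induction e with
  | zero => intro _; simpa using hx
  | succ e ih =>
    intro he
    rw [Function.iterate_succ_apply']
    apply hpar
    have := ih (by omega)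
    rwa [show ℓ - (e + 1) + 1 = ℓ - e by omega]

theorem closing {V : Type*} (G : SimpleGraph V) (Good : ℕ → V → Prop) (lev : V → ℕ) (par : V → V)
    (hlev : ∀ i x, Good i x → lev x = i)
    (hpar : ∀ i x, Good (i + 1) x → Good i (par x) ∧ G.Adj (par x) x)
    (ℓ k t s : ℕ) (ht : 1 ≤ t) (hs : 1 ≤ s) (hk : t + s = k) (hsl : s ≤ ℓ)
    (P : ℕ → V) (hinj : ∀ i j, i < j → j ≤ 2 * t → P i ≠ P j)
    (hadj : ∀ i, i < 2 * t → G.Adj (P i) (P (i + 1)))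
    (hP : ∀ i, i ≤ 2 * t → ℓ ≤ lev (P i))
    (h0 : Good ℓ (P 0)) (h1 : Good ℓ (P (2 * t)))
    (hsame : par^[s] (P 0) = par^[s] (P (2 * t)))
    (hdiff : par^[s - 1] (P 0) ≠ par^[s - 1] (P (2 * t))) : G.HasCycleOfLength (2 * k) := by
  have g0 := good_iter Good par (fun i x h => (hpar i x h).1) ℓ (P 0) h0
  have g1 := good_iter Good par (fun i x h => (hpar i x h).1) ℓ (P (2 * t)) h1
  have adjit : ∀ x, Good ℓ x → ∀ e, e + 1 ≤ ℓ → G.Adj (par^[e + 1] x) (par^[e] x) := by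
    intro x hx e he
    have := good_iter Good par (fun i x h => (hpar i x h).1) ℓ x hx e (by omega)
    rw [Function.iterate_succ_apply']
    refine (hpar (ℓ - (e + 1)) _ ?_).2
    rwa [show ℓ - (e + 1) + 1 = ℓ - e by omega]
  have hne : ∀ e, e ≤ s - 1 → par^[e] (P 0) ≠ par^[e] (P (2 * t)) := by
    intro e he heq
    apply hdiff
    have : s - 1 = (s - 1 - e) + e := by omega
    rw [this, Function.iterate_add_apply, Function.iterate_add_apply, heq]
  set h : ℕ → V := fun i => if i ≤ 2 * t then P i else
    if i ≤ 2 * t + s then par^[i - 2 * t] (P (2 * t)) else par^[2 * k - i] (P 0) with hh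
  have hA : ∀ i, i ≤ 2 * t → h i = P i := by intro i hi; simp [hh, hi]
  have hB : ∀ i, 2 * t ≤ i → i ≤ 2 * t + s → h i = par^[i - 2 * t] (P (2 * t)) := by
    intro i hi hi2
    by_cases hc : i = 2 * t
    · subst hc; simp [hh]
    · simp only [hh]; rw [if_neg (by omega), if_pos hi2]
  have hC : ∀ i, 2 * t + s ≤ i → h i = par^[2 * k - i] (P 0) := by
    intro i hi
    by_cases hc : i = 2 * t + s
    · rw [hB i (by omega) (by omega), hc, show 2 * t + s - 2 * t = s by omega,
        show 2 * k - (2 * t + s) = s by omega, hsame]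
    · simp only [hh]; rw [if_neg (by omega), if_neg (by omega)]
  have lB : ∀ i, 2 * t ≤ i → i ≤ 2 * t + s → lev (h i) = ℓ - (i - 2 * t) := by
    intro i hi hi2
    rw [hB i hi hi2]; exact hlev _ _ (g1 _ (by omega))
  have lC : ∀ i, 2 * t + s ≤ i → i ≤ 2 * k → lev (h i) = ℓ - (2 * k - i) := by
    intro i hi hi2
    rw [hC i hi]; exact hlev _ _ (g0 _ (by omega))
  refine hasCycle_of_nat G (2 * k) (by omega) h ?_ ?_ ?_
  · intro i j hij hj heq
    by_cases hj1 : j ≤ 2 * t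
    · rw [hA i (by omega), hA j hj1] at heq
      exact hinj i j hij hj1 heq
    by_cases hi1 : i ≤ 2 * t
    · have e1 := hP i hi1
      rw [← hA i hi1, heq] at e1
      by_cases hj2 : j ≤ 2 * t + s
      · rw [lB j (by omega) hj2] at e1; omega
      · rw [lC j (by omega) (by omega)] at e1; omega
    by_cases hj2 : j ≤ 2 * t + s
    · have e1 := lB j (by omega) hj2
      rw [← heq, lB i (by omega) (by omega)] at e1; omega
    by_cases hi2 : i ≤ 2 * t + s
    · have e1 := lC j (by omega) (by omega)
      rw [← heq, lB i (by omega) (by omega)] at e1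
      have e2 : i - 2 * t = 2 * k - j := by omega
      rw [hB i (by omega) hi2, hC j (by omega), e2] at heq
      exact hne _ (by omega) heq.symm
    · have e1 := lC j (by omega) (by omega)
      rw [← heq, lC i (by omega) (by omega)] at e1; omega
  · intro i hi
    by_cases h1' : i < 2 * t
    · rw [hA i (by omega), hA _ (by omega)]; exact hadj i h1'
    by_cases h2' : i < 2 * t + s
    · rw [hB i (by omega) (by omega), hB (i + 1) (by omega) (by omega),
        show i + 1 - 2 * t = (i - 2 * t) + 1 by omega]
      exact (adjit _ h1 _ (by omega)).symm
    · rw [hC i (by omega), hC (i + 1) (by omega),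
        show 2 * k - i = (2 * k - (i + 1)) + 1 by omega]
      exact adjit _ h0 _ (by omega)
  · rw [hC _ (by omega), hA 0 (by omega), show 2 * k - (2 * k - 1) = 0 + 1 by omega]
    exact adjit _ h0 0 (by omega)

theorem theta {V : Type*} (H : SimpleGraph V) (L : Set V)
    (hb : ∀ x y, H.Adj x y → (x ∈ L ↔ y ∉ L)) (g : ℤ → V) (N r : ℤ) (t : ℕ) (ht : 1 ≤ t)
    (hper : ∀ z, g (z + N) = g z)
    (hinj : ∀ i j, i < j → j < i + N → g i ≠ g j)
    (hadj : ∀ z, H.Adj (g z) (g (z + 1)))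
    (hchord : H.Adj (g 0) (g r)) (hr : 2 * (t : ℤ) ≤ r) (hNr : 2 * (t : ℤ) ≤ N - r)
    (c : V → V)
    (hc : ∀ P : ℕ → V, (∀ i j, i < j → j ≤ 2 * t → P i ≠ P j) →
      (∀ i, i < 2 * t → H.Adj (P i) (P (i + 1))) → (∀ i, ∃ z, P i = g z) →
      P 0 ∈ L → P (2 * t) ∈ L → c (P 0) = c (P (2 * t))) :
    ∀ z z', g z ∈ L → g z' ∈ L → c (g z) = c (g z') := by
  have step : ∀ z, g z ∈ L ↔ g (z + 1) ∉ L := fun z => hb _ _ (hadj z)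
  have step2 : ∀ z, g z ∈ L ↔ g (z + 2) ∈ L := by
    intro z
    rw [step z, step (z + 1), not_not, add_assoc]; norm_num
  have stepm : ∀ m z : ℤ, g z ∈ L ↔ g (z + 2 * m) ∈ L := by
    intro m
    induction m using Int.induction_on with
    | zero => intro z; simp
    | succ i ih => intro z; rw [ih z, step2]; ring_nf
    | pred i ih => intro z; rw [ih z, step2 (z + 2 * (-(i : ℤ) - 1))]; ring_nf
  have par : ∀ z z', g z ∈ L → g z' ∈ L → ∃ m, z' = z + 2 * m := by
    intro z z' h1 h2
    rcases Int.even_or_odd' (z' - z) with ⟨m, hm | hm⟩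
    · exact ⟨m, by omega⟩
    · exfalso
      have := (stepm m z).1 h1
      rw [step] at this
      apply this
      rwa [show z + 2 * m + 1 = z' by omega]
  have rodd : ∃ q, r = 2 * q + 1 := by
    rcases Int.even_or_odd' r with ⟨m, hm | hm⟩
    · exfalso
      have h1 := hb _ _ hchord
      have h2 := stepm m 0
      rw [zero_add, ← hm] at h2
      tauto
    · exact ⟨m, hm⟩
  obtain ⟨q, hq⟩ := rodd
  -- period
  have period : ∀ z, g z ∈ L → c (g z) = c (g (z + 2 * (t : ℤ))) := by
    intro z hz
    have := hc (fun i => g (z + i)) ?_ ?_ (fun i => ⟨_, rfl⟩) (by simpa using hz) ?_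
    · simpa using this
    · intro i j hij hj
      exact hinj _ _ (by omega) (by omega)
    · intro i hi
      have := hadj (z + i)
      rw [add_assoc] at this
      simpa using this
    · have := (stepm t z).1 hz
      simpa using this
  have periodm : ∀ m z : ℤ, g z ∈ L → c (g z) = c (g (z + 2 * (t : ℤ) * m)) := by
    intro m
    induction m using Int.induction_on with
    | zero => intro z _; simp
    | succ i ih =>
      intro z hz
      rw [ih z hz, period]
      · ring_nf
      · have := (stepm (t * i) z).1 hz
        convert this using 2; ring
    | pred i ih =>
      intro z hz
      rw [ih z hz, period (z + 2 * (t : ℤ) * (-(i : ℤ) - 1))]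
      · ring_nf
      · have := (stepm (t * (-(i : ℤ) - 1)) z).1 hz
        convert this using 2; ring
  -- F identity
  have F0 : ∀ a : ℕ, a < 2 * t → g (-(a : ℤ)) ∈ L →
      c (g (-(a : ℤ))) = c (g (r + 1 + a - 2 * t)) := by
    intro a ha hz
    have key := hc (fun i => if i ≤ a then g (-(a : ℤ) + i) else g (r - ((i : ℤ) - a - 1)))
      ?_ ?_ ?_ (by simpa using hz) ?_
    · simp only [zero_le, if_true] at key
      rw [if_neg (by omega)] at key
      convert key using 3
      · simp
      · push_cast; ring
    · intro i j hij hj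
      by_cases h1 : j ≤ a
      · simp only [if_pos h1, if_pos (show i ≤ a by omega)]
        exact hinj _ _ (by omega) (by omega)
      · by_cases h2 : i ≤ a
        · simp only [if_neg h1, if_pos h2]
          exact hinj _ _ (by omega) (by omega)
        · simp only [if_neg h1, if_neg h2]
          exact (hinj _ _ (by omega) (by omega)).symm
    · intro i hi
      rcases lt_trichotomy i a with h1 | h1 | h1
      · simp only [if_pos (show i ≤ a by omega), if_pos (show i + 1 ≤ a by omega)]
        have := hadj (-(a : ℤ) + i)
        rw [add_assoc] at this
        simpa using this
      · simp only [if_pos (show i ≤ a by omega), if_neg (show ¬ i + 1 ≤ a by omega)]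
        convert hchord using 2 <;> · push_cast; omega
      · simp only [if_neg (show ¬ i ≤ a by omega), if_neg (show ¬ i + 1 ≤ a by omega)]
        have := (hadj (r - (((i + 1 : ℕ) : ℤ) - a - 1))).symm
        convert this using 2; push_cast; ring
    · intro i
      by_cases h1 : i ≤ a
      · exact ⟨-(a : ℤ) + i, by simp [h1]⟩
      · exact ⟨r - ((i : ℤ) - a - 1), by simp [h1]⟩
    · show (if 2 * t ≤ a then _ else _) ∈ L
      rw [if_neg (by omega)]
      have := (stepm (q + 1 + a - t) (-(a : ℤ))).1 hz
      convert this using 2; push_cast; omega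
  have G0 : ∀ a : ℕ, a < 2 * t → g (a : ℤ) ∈ L →
      c (g (a : ℤ)) = c (g (r - 1 - a + 2 * t)) := by
    intro a ha hz
    have key := hc (fun i => if i ≤ a then g ((a : ℤ) - i) else g (r + ((i : ℤ) - a - 1)))
      ?_ ?_ ?_ (by simpa using hz) ?_
    · simp only [zero_le, if_true] at key
      rw [if_neg (by omega)] at key
      convert key using 3
      · simp
      · push_cast; ring
    · intro i j hij hj
      by_cases h1 : j ≤ a
      · simp only [if_pos h1, if_pos (show i ≤ a by omega)]
        exact (hinj _ _ (by omega) (by omega)).symm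
      · by_cases h2 : i ≤ a
        · simp only [if_neg h1, if_pos h2]
          exact hinj _ _ (by omega) (by omega)
        · simp only [if_neg h1, if_neg h2]
          exact hinj _ _ (by omega) (by omega)
    · intro i hi
      rcases lt_trichotomy i a with h1 | h1 | h1
      · simp only [if_pos (show i ≤ a by omega), if_pos (show i + 1 ≤ a by omega)]
        have := (hadj ((a : ℤ) - ((i + 1 : ℕ) : ℤ))).symm
        convert this using 2; push_cast; ring
      · simp only [if_pos (show i ≤ a by omega), if_neg (show ¬ i + 1 ≤ a by omega)]
        convert hchord using 2 <;> · push_cast; omega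
      · simp only [if_neg (show ¬ i ≤ a by omega), if_neg (show ¬ i + 1 ≤ a by omega)]
        have := hadj (r + ((i : ℤ) - a - 1))
        convert this using 2; push_cast; ring
    · intro i
      by_cases h1 : i ≤ a
      · exact ⟨(a : ℤ) - i, by simp [h1]⟩
      · exact ⟨r + ((i : ℤ) - a - 1), by simp [h1]⟩
    · show (if 2 * t ≤ a then _ else _) ∈ L
      rw [if_neg (by omega)]
      have := (stepm (q - a + t) (a : ℤ)).1 hz
      convert this using 2; push_cast; omega
  have t0 : (0 : ℤ) < 2 * t := by omega
  have red : ∀ a : ℤ, ∃ b : ℕ, ∃ m : ℤ, b < 2 * t ∧ a = b + 2 * t * m := by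
    intro a
    refine ⟨(a % (2 * t)).toNat, a / (2 * t), ?_, ?_⟩
    · have := Int.emod_lt_of_pos a t0
      have := Int.emod_nonneg a t0.ne'
      omega
    · rw [Int.toNat_of_nonneg (Int.emod_nonneg a t0.ne')]
      exact (Int.emod_add_mul_ediv a _).symm
  have F1 : ∀ a : ℤ, g (-a) ∈ L → c (g (-a)) = c (g (r + 1 + a)) := by
    intro a hz
    obtain ⟨b, m, hb1, rfl⟩ := red a
    have hz' : g (-(b : ℤ)) ∈ L := by
      have := (stepm (t * m) _).1 hz
      convert this using 2; ring
    have hz2 : g (r + 1 + b - 2 * t) ∈ L := by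
      have := (stepm (q + 1 + b - t) _).1 hz'
      convert this using 2; omega
    have e1 := periodm m _ hz
    have e2 := F0 b hb1 hz'
    have e3 := periodm (m + 1) _ hz2
    rw [e1]
    calc _ = c (g (-(b : ℤ))) := by ring_nf
      _ = _ := e2
      _ = _ := e3
      _ = _ := by ring_nf
  have G1 : ∀ a : ℤ, g a ∈ L → c (g a) = c (g (r - 1 - a)) := by
    intro a hz
    obtain ⟨b, m, hb1, rfl⟩ := red a
    have hz' : g (b : ℤ) ∈ L := by
      have := (stepm (-(t * m)) _).1 hz
      convert this using 2; ring
    have hz2 : g (r - 1 - b + 2 * t) ∈ L := by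
      have := (stepm (q - b + t) _).1 hz'
      convert this using 2; omega
    have e1 := periodm (-m) _ hz
    have e2 := G0 b hb1 hz'
    have e3 := periodm (-(m + 1)) _ hz2
    rw [e1]
    calc _ = c (g (b : ℤ)) := by ring_nf
      _ = _ := e2
      _ = _ := e3
      _ = _ := by ring_nf
  have two : ∀ z, g z ∈ L → c (g z) = c (g (z + 2)) := by
    intro z hz
    have hz1 : g (r - 1 - z) ∈ L := by
      have := (stepm (q - z) z).1 hz
      convert this using 2; omega
    have e1 := G1 (r - 1 - z) hz1
    have e2 := F1 (z - r + 1) (by convert hz1 using 2; ring)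
    calc c (g z) = c (g (r - 1 - (r - 1 - z))) := by ring_nf
      _ = _ := e1.symm
      _ = c (g (-(z - r + 1))) := by ring_nf
      _ = _ := e2
      _ = _ := by ring_nf
  have twom : ∀ m z : ℤ, g z ∈ L → c (g z) = c (g (z + 2 * m)) := by
    intro m
    induction m using Int.induction_on with
    | zero => intro z _; simp
    | succ i ih =>
      intro z hz
      rw [ih z hz, two _ ((stepm _ _).1 hz)]
      ring_nf
    | pred i ih =>
      intro z hz
      rw [ih z hz, two (z + 2 * (-(i : ℤ) - 1)) ((stepm _ _).1 hz)]
      ring_nf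
  intro z z' h1 h2
  obtain ⟨m, rfl⟩ := par z z' h1 h2
  exact twom m z h1

theorem mindeg {V : Type*} [Fintype V] (H : SimpleGraph V) (L : Set V)
    (hb : ∀ x y, H.Adj x y → (x ∈ L ↔ y ∉ L)) (d : ℕ) (hd : 0 < d) :
    ∀ S : Finset V, S.Nonempty →
      d * S.card ≤ ((S ×ˢ S).filter (fun p => p.1 ∈ L ∧ H.Adj p.1 p.2)).card →
      ∃ T : Finset V, T.Nonempty ∧ ∀ x ∈ T, d ≤ (T.filter (fun y => H.Adj x y)).card := by
  intro S
  induction S using Finset.strongInduction with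
  | H S ih =>
    intro hne hcard
    by_cases hall : ∀ x ∈ S, d ≤ (S.filter (fun y => H.Adj x y)).card
    · exact ⟨S, hne, hall⟩
    push Not at hall
    obtain ⟨x, hx, hlt⟩ := hall
    have hsub : (S ×ˢ S).filter (fun p => p.1 ∈ L ∧ H.Adj p.1 p.2) ⊆
        (((S.erase x) ×ˢ (S.erase x)).filter (fun p => p.1 ∈ L ∧ H.Adj p.1 p.2)) ∪
        (S.filter (fun y => H.Adj x y)).image (fun y => if x ∈ L then (x, y) else (y, x)) := by
      rintro ⟨a, b⟩ hab
      simp only [Finset.mem_filter, Finset.mem_product] at hab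
      obtain ⟨⟨ha, hb'⟩, haL, hadj⟩ := hab
      have hbL := (hb _ _ hadj).1 haL
      simp only [Finset.mem_union, Finset.mem_filter, Finset.mem_product, Finset.mem_erase,
        Finset.mem_image]
      by_cases h1 : a = x
      · right
        subst h1
        exact ⟨b, ⟨hb', hadj⟩, by simp [haL]⟩
      · by_cases h2 : b = x
        · right
          subst h2
          exact ⟨a, ⟨ha, hadj.symm⟩, by simp [hbL]⟩
        · left
          exact ⟨⟨⟨h1, ha⟩, h2, hb'⟩, haL, hadj⟩
    have h1 := (Finset.card_le_card hsub).trans (Finset.card_union_le _ _)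
    have h2 : ((S.filter (fun y => H.Adj x y)).image
      (fun y => if x ∈ L then (x, y) else (y, x))).card ≤ (S.filter (fun y => H.Adj x y)).card :=
      Finset.card_image_le
    have h3 := Finset.card_erase_add_one hx
    have h4 : d * S.card = d * (S.erase x).card + d := by rw [← h3]; ring
    by_cases hem : (S.erase x).Nonempty
    · exact ih _ (Finset.erase_ssubset hx) hem (by omega)
    · exfalso
      rw [Finset.not_nonempty_iff_eq_empty] at hem
      simp [hem] at h1 h4
      omega

theorem find_theta {V : Type*} [Fintype V] (H : SimpleGraph V) (L : Set V)
    (hb : ∀ x y, H.Adj x y → (x ∈ L ↔ y ∉ L)) (k : ℕ) (hk : 2 ≤ k) (T : Finset V)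
    (hne : T.Nonempty) (hdeg : ∀ x ∈ T, 2 * k ≤ (T.filter (fun y => H.Adj x y)).card) :
    ∃ (g : ℤ → V) (N r : ℤ), (∀ z, g (z + N) = g z) ∧
      (∀ i j, i < j → j < i + N → g i ≠ g j) ∧ (∀ z, H.Adj (g z) (g (z + 1))) ∧
      H.Adj (g 0) (g r) ∧ 2 * (k : ℤ) - 2 ≤ r ∧ 2 * (k : ℤ) - 2 ≤ N - r := by
  set Q : ℕ → Prop := fun m => ∃ p : ℕ → V, (∀ i, i ≤ m → p i ∈ T) ∧
    (∀ i j, i < j → j ≤ m → p i ≠ p j) ∧ (∀ i, i < m → H.Adj (p i) (p (i + 1))) with hQ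
  have hbound : ∀ m, Q m → m ≤ T.card := by
    rintro m ⟨p, h1, h2, -⟩
    have : (Finset.range (m + 1)).card ≤ T.card := by
      apply Finset.card_le_card_of_injOn p
      · intro i hi
        simp at hi
        exact h1 i (by omega)
      · intro i hi j hj hij
        simp at hi hj
        rcases lt_trichotomy i j with h | h | h
        · exact absurd hij (h2 i j h (by omega))
        · exact h
        · exact absurd hij.symm (h2 j i h (by omega))
    simp at this
    omega
  have hQ0 : Q 0 := by
    obtain ⟨x, hx⟩ := hne
    exact ⟨fun _ => x, fun _ _ => hx, fun i j h1 h2 => by omega, fun i h => by omega⟩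
  obtain ⟨m, hm, hmax⟩ : ∃ m, Q m ∧ ¬ Q (m + 1) := by
    by_contra hcon
    push Not at hcon
    have : ∀ m, Q m := fun m => Nat.rec hQ0 (fun m ih => hcon m ih) m
    have := hbound _ (this (T.card + 1))
    omega
  obtain ⟨p, hpT, hpinj, hpadj⟩ := hm
  have hnb : ∀ y ∈ T, H.Adj (p 0) y → ∃ i, i ≤ m ∧ p i = y := by
    intro y hy hadj
    by_contra hcon
    push Not at hcon
    apply hmax
    refine ⟨fun i => if i = 0 then y else p (i - 1), ?_, ?_, ?_⟩
    · intro i hi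
      by_cases h : i = 0
      · simp [h, hy]
      · simp only [h, if_false]; exact hpT _ (by omega)
    · intro i j hij hj
      by_cases h : i = 0
      · simp only [h, if_true, if_neg (show j ≠ 0 by omega)]
        exact (hcon _ (by omega)).symm
      · simp only [if_neg h, if_neg (show j ≠ 0 by omega)]
        exact hpinj _ _ (by omega) (by omega)
    · intro i hi
      by_cases h : i = 0
      · simp only [h, if_true]; simpa using hadj.symm
      · simp only [if_neg h, if_neg (show i + 1 ≠ 0 by omega)]
        have := hpadj (i - 1) (by omega)
        rwa [show i - 1 + 1 = i by omega] at this
  set I : Finset ℕ := (Finset.range (m + 1)).filter (fun i => H.Adj (p 0) (p i)) with hI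
  have hIcard : 2 * k ≤ I.card := by
    refine (hdeg (p 0) (hpT 0 (by omega))).trans ?_
    refine (Finset.card_le_card (t := I.image p) ?_).trans Finset.card_image_le
    intro y hy
    simp only [Finset.mem_filter] at hy
    obtain ⟨i, hi, rfl⟩ := hnb y hy.1 hy.2
    exact Finset.mem_image_of_mem _ (by simp [hI, hy.2]; omega)
  have hpar : ∀ i, i ≤ m → ((p i ∈ L ↔ p 0 ∈ L) ↔ i % 2 = 0) := by
    intro i
    induction i with
    | zero => simp
    | succ i ih =>
      intro hi
      have h1 := ih (by omega)
      have h2 := hb _ _ (hpadj i (by omega))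
      rcases Nat.mod_two_eq_zero_or_one i with h3 | h3
      · have : (i + 1) % 2 = 1 := by omega
        simp only [h3, this] at *
        tauto
      · have : (i + 1) % 2 = 0 := by omega
        simp only [h3, this] at *
        tauto
  have hodd : ∀ i ∈ I, i % 2 = 1 ∧ i ≤ m ∧ H.Adj (p 0) (p i) := by
    intro i hi
    simp only [hI, Finset.mem_filter, Finset.mem_range] at hi
    have h1 := hpar i (by omega)
    have h2 := hb _ _ hi.2
    refine ⟨?_, by omega, hi.2⟩
    rcases Nat.mod_two_eq_zero_or_one i with h3 | h3
    · simp only [h3] at h1; tauto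
    · exact h3
  have hIne : I.Nonempty := by
    rw [← Finset.card_pos]; omega
  set q := I.max' hIne with hq
  have hqI : q ∈ I := Finset.max'_mem _ _
  have hqmax : ∀ i ∈ I, i ≤ q := fun i hi => Finset.le_max' _ _ hi
  obtain ⟨r, hrI, hr1, hr2⟩ : ∃ r ∈ I, 2 * k - 1 ≤ r ∧ r + 2 * k ≤ q + 2 := by
    by_contra hcon
    push Not at hcon
    have hsub : I ⊆ (Finset.range (k - 1)).image (fun i => 2 * i + 1) ∪
        (Finset.range k).image (fun i => q - 2 * i) := by
      intro i hi
      have h1 := hcon i hi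
      have h2 := hodd i hi
      have h3 := hodd q hqI
      have h4 := hqmax i hi
      simp only [Finset.mem_union, Finset.mem_image, Finset.mem_range]
      by_cases h5 : 2 * k - 1 ≤ i
      · right
        have := h1 h5
        exact ⟨(q - i) / 2, by omega, by omega⟩
      · left
        exact ⟨i / 2, by omega, by omega⟩
    have h1 := (Finset.card_le_card hsub).trans (Finset.card_union_le _ _)
    have h2 : ((Finset.range (k - 1)).image (fun i => 2 * i + 1)).card ≤ _ := Finset.card_image_le
    have h3 : ((Finset.range k).image (fun i => q - 2 * i)).card ≤ _ := Finset.card_image_le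
    rw [Finset.card_range] at h2 h3
    omega
  have hqq := hodd q hqI
  have hrr := hodd r hrI
  have hrq := hqmax r hrI
  have N0 : (0 : ℤ) < (q : ℤ) + 1 := by omega
  have gval : ∀ z : ℤ, ∃ a : ℕ, a ≤ q ∧ (z % ((q : ℤ) + 1)) = a := by
    intro z
    have h1 := Int.emod_nonneg z N0.ne'
    have h2 := Int.emod_lt_of_pos z N0
    exact ⟨(z % ((q : ℤ) + 1)).toNat, by omega, by omega⟩
  refine ⟨fun z => p (z % ((q : ℤ) + 1)).toNat, (q : ℤ) + 1, r, ?_, ?_, ?_, ?_, by omega, by omega⟩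
  · intro z; simp
  · intro i j hij hj heq
    obtain ⟨a, ha, ha'⟩ := gval i
    obtain ⟨b, hb', hb''⟩ := gval j
    simp only [ha', hb'', Int.toNat_natCast] at heq
    have hab : a = b := by
      rcases lt_trichotomy a b with h | h | h
      · exact absurd heq (hpinj _ _ h (by omega))
      · exact h
      · exact absurd heq.symm (hpinj _ _ h (by omega))
    have h1 : j % ((q : ℤ) + 1) = i % ((q : ℤ) + 1) := by rw [ha', hb'', hab]
    have h2 := Int.emod_emod_of_dvd
    have h3 : ((q : ℤ) + 1) ∣ j - i := Int.ModEq.dvd (h1.symm)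
    have := Int.le_of_dvd (by omega) h3
    omega
  · intro z
    obtain ⟨a, ha, ha'⟩ := gval z
    have h1 : (z + 1) % ((q : ℤ) + 1) = ((a : ℤ) + 1) % ((q : ℤ) + 1) := by
      rw [← ha', Int.emod_add_emod]
    simp only [ha', h1, Int.toNat_natCast]
    by_cases h2 : a = q
    · subst h2
      simpa using hqq.2.2.symm
    · rw [Int.emod_eq_of_lt (by omega) (by omega)]
      exact hpadj a (by omega)
  · have : (r : ℤ) % ((q : ℤ) + 1) = r := Int.emod_eq_of_lt (by omega) (by omega)
    simpa [this] using hrr.2.2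

theorem count_ext {V : Type*} [Fintype V] (m : ℕ) (hm : 0 < m) (y : Fin m → V)
    (hy : Function.Injective y) :
    Fintype.card (V → Fin m) ≤ m ^ m *
      ((Finset.univ : Finset (V → Fin m)).filter (fun f => ∀ i, f (y i) = i)).card := by
  have hinj : Function.Injective (fun f : V → Fin m =>
      ((fun i => f (y i) : Fin m → Fin m),
        (fun x => if h : ∃ i, y i = x then h.choose else f x : V → Fin m))) := by
    intro f f' hff
    simp only [Prod.mk.injEq] at hff
    funext x
    by_cases h : ∃ i, y i = x
    · obtain ⟨i, rfl⟩ := h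
      exact congrFun hff.1 i
    · have := congrFun hff.2 x
      simpa [h] using this
  have h1 := Finset.card_le_card_of_injOn (s := (Finset.univ : Finset (V → Fin m)))
    (t := (Finset.univ : Finset (Fin m → Fin m)) ×ˢ
      ((Finset.univ : Finset (V → Fin m)).filter (fun f => ∀ i, f (y i) = i))) _ ?_ hinj.injOn
  · rw [Finset.card_product] at h1
    simpa using h1
  · intro f _
    simp only [Finset.coe_product, Set.mem_prod, Finset.coe_univ, Set.mem_univ, true_and,
      Finset.coe_filter, Finset.mem_univ, Set.mem_ofPred_eq]
    intro i
    have h : ∃ j, y j = y i := ⟨i, rfl⟩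
    rw [dif_pos h]
    exact hy h.choose_spec

theorem averaging {V ι : Type*} [Fintype V] (m : ℕ) (hm : 0 < m) (X : Finset ι)
    (y : ι → Fin m → V) (hy : ∀ x ∈ X, Function.Injective (y x)) :
    ∃ f : V → Fin m, X.card ≤ m ^ m * (X.filter (fun x => ∀ i, f (y x i) = i)).card := by
  by_contra hcon
  push Not at hcon
  have : Nonempty (Fin m) := ⟨⟨0, hm⟩⟩
  have h1 : ∑ f : V → Fin m, m ^ m * (X.filter (fun x => ∀ i, f (y x i) = i)).card <
      ∑ f : V → Fin m, X.card :=
    Finset.sum_lt_sum_of_nonempty Finset.univ_nonempty (fun f _ => hcon f)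
  rw [← Finset.mul_sum] at h1
  have h2 : ∑ f : V → Fin m, (X.filter (fun x => ∀ i, f (y x i) = i)).card =
      ∑ x ∈ X, ((Finset.univ : Finset (V → Fin m)).filter (fun f => ∀ i, f (y x i) = i)).card := by
    simp only [Finset.card_filter]
    exact Finset.sum_comm
  rw [h2, Finset.mul_sum, Finset.sum_const, Finset.card_univ, smul_eq_mul] at h1
  have h3 : ∑ x ∈ X, Fintype.card (V → Fin m) ≤ ∑ x ∈ X, m ^ m *
      ((Finset.univ : Finset (V → Fin m)).filter (fun f => ∀ i, f (y x i) = i)).card :=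
    Finset.sum_le_sum (fun x hx => count_ext m hm (y x) (hy x hx))
  rw [Finset.sum_const, smul_eq_mul, mul_comm] at h3
  omega

theorem arith_bound (k ℓ : ℕ) (h1 : 1 ≤ ℓ) (h2 : ℓ + 1 ≤ k) :
    (ℓ + 1) ^ (ℓ + 1) * (2 * k) + (ℓ + 1) ≤ 6 * (2 * k) ^ ℓ := by
  obtain ⟨j, rfl⟩ : ∃ j, ℓ = j + 1 := ⟨ℓ - 1, by omega⟩
  have h3 : ∀ j : ℕ, (j + 2) ^ 2 + 1 ≤ 6 * 2 ^ j := by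
    intro j
    rcases j with _ | _ | j
    · norm_num
    · norm_num
    · induction j with
      | zero => norm_num
      | succ j ih => 
        have : 6 * 2 ^ (j + 1 + 1 + 1) = 2 * (6 * 2 ^ (j + 1 + 1)) := by ring
        rw [this]; refine le_trans ?_ (Nat.mul_le_mul_left 2 ih); nlinarith [Nat.zero_le (j ^ 2), Nat.zero_le j]
  have h4 : (2 * (j + 2)) ^ j ≤ (2 * k) ^ j := Nat.pow_le_pow_left (by omega) _
  have h5 : (j + 2) ^ (j + 2) + 1 ≤ 6 * (2 * k) ^ j := by
    have h6 : 1 ≤ (j + 2) ^ j := Nat.one_le_pow _ _ (by omega)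
    calc (j + 2) ^ (j + 2) + 1 ≤ (j + 2) ^ j * ((j + 2) ^ 2 + 1) := by
          rw [pow_add (j + 2) j 2]; nlinarith
      _ ≤ (j + 2) ^ j * (6 * 2 ^ j) := Nat.mul_le_mul_left _ (h3 j)
      _ = 6 * (2 * (j + 2)) ^ j := by rw [mul_pow]; ring
      _ ≤ _ := by omega
  calc (j + 1 + 1) ^ (j + 1 + 1) * (2 * k) + (j + 1 + 1)
      ≤ ((j + 2) ^ (j + 2) + 1) * (2 * k) := by
        rw [add_mul]
        have : j + 1 + 1 = j + 2 := rfl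
        rw [this]
        omega
    _ ≤ 6 * (2 * k) ^ j * (2 * k) := Nat.mul_le_mul_right _ h5
    _ = _ := by rw [pow_succ]; ring

/-- vertices reachable from `v` by a path whose `i`-th vertex has colour `i` -/
def GoodLevel {V : Type*} (G : SimpleGraph V) (f : V → ℕ) (v : V) : ℕ → V → Prop
  | 0, x => x = v
  | i + 1, x => x ≠ v ∧ f x = i + 1 ∧ ∃ y, GoodLevel G f v i y ∧ G.Adj y x

theorem core {V : Type*} [Fintype V] (G : SimpleGraph V) (k ℓ : ℕ) (hk : 2 ≤ k) (h1 : 1 ≤ ℓ)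
    (h2 : ℓ + 1 ≤ k) (v : V) (f : V → ℕ)
    (hcount : 2 * k * Fintype.card V ≤ ((Finset.univ : Finset (V × V)).filter
      (fun p => GoodLevel G f v ℓ p.1 ∧ p.2 ≠ v ∧ f p.2 = 0 ∧ G.Adj p.1 p.2)).card) :
    G.HasCycleOfLength (2 * k) := by
  set Good := GoodLevel G f v with hGood
  set L : Set V := {x | Good ℓ x} with hL
  set lev : V → ℕ := fun x => if x = v then 0 else if f x = 0 then ℓ + 1 else f x with hlevdef
  have hlev : ∀ i x, Good i x → lev x = i := by
    intro i x hx
    cases i with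
    | zero =>
      have : x = v := hx
      simp [hlevdef, this]
    | succ i =>
      obtain ⟨a, b, -⟩ := hx
      simp [hlevdef, a, b]
  have hWlev : ∀ x, x ≠ v → f x = 0 → lev x = ℓ + 1 := by
    intro x a b; simp [hlevdef, a, b]
  have hex : ∀ x, ∃ y, ∀ i, Good (i + 1) x → Good i y ∧ G.Adj y x := by
    intro x
    by_cases h : ∃ i, Good (i + 1) x
    · obtain ⟨i, hi⟩ := h
      obtain ⟨y, hy⟩ := hi.2.2
      refine ⟨y, fun j hj => ?_⟩
      have e1 := hlev _ _ hi
      have e2 := hlev _ _ hj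
      have : j = i := by omega
      subst this; exact hy
    · exact ⟨x, fun i hi => absurd ⟨i, hi⟩ h⟩
  choose par hpar using hex
  set H : SimpleGraph V :=
    { Adj := fun x y => G.Adj x y ∧ ((Good ℓ x ∧ y ≠ v ∧ f y = 0) ∨ (Good ℓ y ∧ x ≠ v ∧ f x = 0))
      symm := ⟨fun x y h => ⟨h.1.symm, h.2.symm⟩⟩
      loopless := ⟨fun x h => G.loopless.irrefl x h.1⟩ } with hH
  have hHadj : ∀ x y, H.Adj x y ↔
    G.Adj x y ∧ ((Good ℓ x ∧ y ≠ v ∧ f y = 0) ∨ (Good ℓ y ∧ x ≠ v ∧ f x = 0)) :=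
    fun x y => Iff.rfl
  have hLmem : ∀ x, x ∈ L ↔ Good ℓ x := fun x => Iff.rfl
  have hnot : ∀ x, x ≠ v → f x = 0 → ¬ Good ℓ x := by
    intro x a b c
    have := hlev _ _ c
    rw [hWlev x a b] at this; omega
  have hb : ∀ x y, H.Adj x y → (x ∈ L ↔ y ∉ L) := by
    intro x y hxy
    rw [hHadj] at hxy
    rw [hLmem, hLmem]
    rcases hxy.2 with ⟨a, b, c⟩ | ⟨a, b, c⟩
    · have := hnot y b c; tauto
    · have := hnot x b c; tauto
  have hHlev : ∀ x y, H.Adj x y → ℓ ≤ lev x := by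
    intro x y hxy
    rw [hHadj] at hxy
    rcases hxy.2 with ⟨a, b, c⟩ | ⟨a, b, c⟩
    · exact (hlev _ _ a).ge
    · rw [hWlev x b c]; omega
  obtain ⟨T, hT, hTdeg⟩ := mindeg H L hb (2 * k) (by omega) Finset.univ ⟨v, Finset.mem_univ _⟩ (by
    rw [Finset.card_univ]
    refine hcount.trans (Finset.card_le_card ?_)
    intro p hp
    simp only [Finset.mem_filter, Finset.mem_univ, true_and, Finset.mem_product] at hp ⊢
    exact ⟨hp.1, hp.2.2.2, Or.inl ⟨hp.1, hp.2.1, hp.2.2.1⟩⟩)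
  obtain ⟨g, N, r, hper, hinj, hadj, hchord, hr, hNr⟩ := find_theta H L hb k hk T hT hTdeg
  by_contra hcyc
  have main : ∀ e, e ≤ ℓ → ∀ z z', g z ∈ L → g z' ∈ L →
      par^[ℓ - e] (g z) = par^[ℓ - e] (g z') := by
    intro e
    induction e with
    | zero =>
      intro _ z z' hz hz'
      have a1 := good_iter Good par (fun i x h => (hpar x i h).1) ℓ _ hz ℓ le_rfl
      have a2 := good_iter Good par (fun i x h => (hpar x i h).1) ℓ _ hz' ℓ le_rfl
      rw [Nat.sub_self] at a1 a2
      have b1 : par^[ℓ] (g z) = v := a1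
      have b2 : par^[ℓ] (g z') = v := a2
      rw [Nat.sub_zero, b1, b2]
    | succ e ih =>
      intro he
      have ih' := ih (by omega)
      refine theta H L hb g N r (k - (ℓ - e)) (by omega) hper hinj hadj hchord (by omega) (by omega)
        (par^[ℓ - (e + 1)]) ?_
      intro P hPinj hPadj hPg hP0 hP1
      by_contra hdiff
      apply hcyc
      refine closing G Good lev par hlev (fun i x h => hpar x i h) ℓ k (k - (ℓ - e)) (ℓ - e)
        (by omega) (by omega) (by omega) (by omega) P hPinj (fun i hi => (hPadj i hi).1) ?_
        hP0 hP1 ?_ ?_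
      · intro i _
        obtain ⟨z, hz⟩ := hPg i
        rw [hz]; exact hHlev _ _ (hadj z)
      · obtain ⟨z, hz⟩ := hPg 0
        obtain ⟨z', hz'⟩ := hPg (2 * (k - (ℓ - e)))
        rw [hz, hz']
        exact ih' z z' (hz ▸ hP0) (hz' ▸ hP1)
      · rwa [show ℓ - e - 1 = ℓ - (e + 1) by omega]
  have fin := main ℓ le_rfl
  simp only [Nat.sub_self, Function.iterate_zero, id] at fin
  have s0 := hb _ _ (hadj 0)
  have s1 := hb _ _ (hadj 1)
  have s2 := hb _ _ (hadj 2)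
  norm_num at s0 s1 s2
  by_cases h0 : g 0 ∈ L
  · exact hinj 0 2 (by omega) (by omega) (fin 0 2 h0 (by tauto))
  · exact hinj 1 3 (by omega) (by omega) (fin 1 3 (by tauto) (by tauto))

/-- Density theorem: if for some vertex `v` and some `1 ≤ ℓ ≤ k - 1` the sum of
degrees over `R_ℓ(v)` (vertices reachable from `v` by a simple path of length
exactly `ℓ`) exceeds `6 · (2k)^ℓ · n`, then `G` has a `2k`-cycle. -/
theorem density_theorem {V : Type*} [Fintype V] [DecidableEq V]
    (G : SimpleGraph V) [DecidableRel G.Adj] (k : ℕ) (hk : 2 ≤ k) (v : V)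
    (ℓ : ℕ) (hℓ1 : 1 ≤ ℓ) (hℓ2 : ℓ ≤ k - 1)
    (h : 6 * (2 * k) ^ ℓ * Fintype.card V <
      ∑ u ∈ Finset.univ.filter
        (fun u => ∃ p : G.Walk v u, p.IsPath ∧ p.length = ℓ), G.degree u) :
    G.HasCycleOfLength (2 * k) := by
  have hP : ∀ u, ∃ p : ℕ → V, (∃ p : G.Walk v u, p.IsPath ∧ p.length = ℓ) →
      p 0 = v ∧ p ℓ = u ∧ (∀ i j, i < j → j ≤ ℓ → p i ≠ p j) ∧
      (∀ i, i < ℓ → G.Adj (p i) (p (i + 1))) := by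
    intro u
    by_cases hu : ∃ p : G.Walk v u, p.IsPath ∧ p.length = ℓ
    · obtain ⟨p, hp, hl⟩ := hu
      refine ⟨p.getVert, fun _ => ⟨p.getVert_zero, ?_, ?_, ?_⟩⟩
      · rw [← hl]; exact p.getVert_length
      · intro i j hij hj heq
        have := hp.getVert_injOn (show i ∈ {i | i ≤ p.length} by simp; omega)
          (show j ∈ {i | i ≤ p.length} by simp; omega) heq
        omega
      · intro i hi
        exact p.adj_getVert_succ (by omega)
    · exact ⟨fun _ => v, fun h => absurd h hu⟩
  choose P hP using hP
  set R := Finset.univ.filter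
        (fun u => ∃ p : G.Walk v u, p.IsPath ∧ p.length = ℓ) with hR
  have hPR : ∀ u ∈ R, P u 0 = v ∧ P u ℓ = u ∧ (∀ i j, i < j → j ≤ ℓ → P u i ≠ P u j) ∧
      (∀ i, i < ℓ → G.Adj (P u i) (P u (i + 1))) := by
    intro u hu
    exact hP u (by simpa [hR] using hu)
  set B : V → Finset V := fun u => (Finset.range (ℓ + 1)).image (P u) with hB
  set X : Finset (Σ _ : V, V) := R.sigma (fun u => G.neighborFinset u \ B u) with hX
  have hXcard : ∑ u ∈ R, G.degree u ≤ X.card + (ℓ + 1) * Fintype.card V := by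
    rw [hX, Finset.card_sigma]
    have e1 : ∑ u ∈ R, G.degree u ≤ ∑ u ∈ R, ((G.neighborFinset u \ B u).card + (ℓ + 1)) := by
      refine Finset.sum_le_sum (fun u _ => ?_)
      have a1 := Finset.le_card_sdiff (B u) (G.neighborFinset u)
      have a2 : (B u).card ≤ ℓ + 1 := Finset.card_image_le.trans (by simp)
      rw [G.card_neighborFinset_eq_degree] at a1
      omega
    rw [Finset.sum_add_distrib, Finset.sum_const, smul_eq_mul] at e1
    have e2 : R.card * (ℓ + 1) ≤ (ℓ + 1) * Fintype.card V := by
      rw [mul_comm]; exact Nat.mul_le_mul_left _ (Finset.card_le_univ _)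
    omega
  obtain ⟨f, hf⟩ := averaging (ℓ + 1) (by omega) X
    (fun x i => if (i : ℕ) = 0 then x.2 else P x.1 i) (by
      rintro ⟨u, w⟩ hx i j hij
      simp only [hX, Finset.mem_sigma, Finset.mem_sdiff] at hx
      obtain ⟨hu, -, hw⟩ := hx
      have hw' : ∀ i, i ≤ ℓ → P u i ≠ w := by
        intro i hi heq
        exact hw (Finset.mem_image.2 ⟨i, by simp; omega, heq⟩)
      obtain ⟨-, -, hinj, -⟩ := hPR u hu
      apply Fin.ext
      have hi := i.2
      have hj := j.2
      by_cases hi0 : (i : ℕ) = 0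
      · by_cases hj0 : (j : ℕ) = 0
        · omega
        · simp only [hi0, hj0, if_true, if_false] at hij
          exact absurd hij.symm (hw' _ (by omega))
      · by_cases hj0 : (j : ℕ) = 0
        · simp only [hi0, hj0, if_true, if_false] at hij
          exact absurd hij (hw' _ (by omega))
        · simp only [hi0, hj0, if_false] at hij
          rcases lt_trichotomy (i : ℕ) (j : ℕ) with h | h | h
          · exact absurd hij (hinj _ _ h (by omega))
          · exact h
          · exact absurd hij.symm (hinj _ _ h (by omega)))
  refine core G k ℓ hk hℓ1 (by omega) v (fun x => (f x : ℕ)) ?_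
  have hle : (X.filter (fun x => ∀ i : Fin (ℓ + 1), f (if (i : ℕ) = 0 then x.2 else P x.1 i) = i)).card ≤
      ((Finset.univ : Finset (V × V)).filter
      (fun p => GoodLevel G (fun x => (f x : ℕ)) v ℓ p.1 ∧ p.2 ≠ v ∧ (f p.2 : ℕ) = 0 ∧
        G.Adj p.1 p.2)).card := by
    apply Finset.card_le_card_of_injOn (fun x => (x.1, x.2))
    · rintro ⟨u, w⟩ hx
      simp only [hX, Finset.coe_filter, Set.mem_ofPred_eq, Finset.mem_sigma, Finset.mem_sdiff,
        SimpleGraph.mem_neighborFinset] at hx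
      obtain ⟨⟨hu, hadj, hw⟩, hcol⟩ := hx
      obtain ⟨h0, hl, hinj, hpadj⟩ := hPR u hu
      simp only [Finset.coe_filter, Set.mem_ofPred_eq, Finset.mem_univ, true_and]
      refine ⟨?_, ?_, ?_, hadj⟩
      · have : ∀ i, i ≤ ℓ → GoodLevel G (fun x => (f x : ℕ)) v i (P u i) := by
          intro i
          induction i with
          | zero => intro _; exact h0
          | succ i ih =>
            intro hi
            refine ⟨?_, ?_, P u i, ih (by omega), hpadj i (by omega)⟩
            · rw [← h0]; exact (hinj 0 (i + 1) (by omega) hi).symm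
            · have := hcol ⟨i + 1, by omega⟩
              simp only [Nat.add_eq_zero_iff, one_ne_zero, and_false, if_false] at this
              simp only [this]
        have := this ℓ le_rfl
        rwa [hl] at this
      · rintro rfl
        exact hw (Finset.mem_image.2 ⟨0, by simp, h0⟩)
      · have := hcol ⟨0, by omega⟩
        simp only [if_true] at this
        simp only [this]
    · rintro ⟨a, b⟩ _ ⟨c, d⟩ _ hh
      simp only [Prod.mk.injEq] at hh
      obtain ⟨rfl, rfl⟩ := hh
      rfl
  refine le_trans ?_ (hle.trans (le_of_eq (by congr)))
  have hm : 0 < (ℓ + 1) ^ (ℓ + 1) := by positivity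
  refine Nat.le_of_mul_le_mul_left ?_ hm
  refine le_trans ?_ hf
  have ha := Nat.mul_le_mul_right (Fintype.card V) (arith_bound k ℓ hℓ1 (by omega))
  rw [add_mul] at ha
  rw [← mul_assoc]
  omega
end

section
/- Let k ≥ 2 be an integer and let G be a simple graph on n vertices. Let v be a vertex of G, let ℓ be an integer with 1 ≤ ℓ ≤ k−1, and let W be the set of vertices u ∈ R_ℓ(v) whose degree satisfies deg(u) ≥ n^{1/k} (as real numbers). If |W| > 6·(2k)^ℓ·n^{1−1/k} (as real numbers), then G contains a cycle of length 2k. -/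
open scoped Classical

/-- Random colouring lemma. -/
lemma aux_coloring {V I : Type*} [Fintype V] (t : ℕ) (ht : 0 < t) (S : Finset I)
    (φ : I → Fin t → V) (hφ : ∀ i ∈ S, Function.Injective (φ i)) :
    ∃ χ : V → Fin t, S.card ≤ t ^ t * (S.filter fun i => ∀ j, χ (φ i j) = j).card := by
  classical
  have key : ∀ i ∈ S, Fintype.card (V → Fin t) ≤
      t ^ t * (Finset.univ.filter fun χ : V → Fin t => ∀ j, χ (φ i j) = j).card := by
    intro i hi
    have hinj := hφ i hi
    let F : (V → Fin t) → (Fin t → Fin t) × (V → Fin t) := fun χ =>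
      (χ ∘ φ i, fun x => if h : ∃ j, φ i j = x then h.choose else χ x)
    have hF : Function.Injective F := by
      intro χ χ' h
      have h1 := congrArg Prod.fst h
      have h2 := congrArg Prod.snd h
      simp only [F] at h1 h2
      funext x
      by_cases hx : ∃ j, φ i j = x
      · obtain ⟨j, rfl⟩ := hx
        exact congrFun h1 j
      · have := congrFun h2 x
        simpa [hx] using this
    have : (Finset.univ : Finset (V → Fin t)).card ≤
      ((Finset.univ : Finset (Fin t → Fin t)) ×ˢ
        (Finset.univ.filter fun χ : V → Fin t => ∀ j, χ (φ i j) = j)).card := by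
      apply Finset.card_le_card_of_injOn F
      · intro χ _
        simp only [F, Finset.coe_product, Set.mem_prod, Finset.mem_coe, Finset.mem_univ,
          Finset.mem_filter, true_and]
        intro j
        have h : ∃ j', φ i j' = φ i j := ⟨j, rfl⟩
        rw [dif_pos h]
        exact hinj h.choose_spec
      · exact hF.injOn
    simpa [Finset.card_product] using this
  by_contra hcon
  push Not at hcon
  have hswap : ∑ χ : V → Fin t, (S.filter fun i => ∀ j, χ (φ i j) = j).card
      = ∑ i ∈ S, (Finset.univ.filter fun χ : V → Fin t => ∀ j, χ (φ i j) = j).card := by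
    simp only [Finset.card_filter]
    exact Finset.sum_comm
  have h1 : ∑ i ∈ S, Fintype.card (V → Fin t) ≤
      ∑ χ : V → Fin t, t ^ t * (S.filter fun i => ∀ j, χ (φ i j) = j).card := by
    rw [← Finset.mul_sum, hswap, Finset.mul_sum]
    exact Finset.sum_le_sum key
  have : Nonempty (V → Fin t) := ⟨fun _ => ⟨0, ht⟩⟩
  · have h2 : ∑ χ : V → Fin t, t ^ t * (S.filter fun i => ∀ j, χ (φ i j) = j).card <
      ∑ χ : V → Fin t, S.card :=
      Finset.sum_lt_sum_of_nonempty Finset.univ_nonempty (fun χ _ => hcon χ)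
    simp only [Finset.sum_const, smul_eq_mul, Finset.card_univ] at h1 h2
    rw [mul_comm] at h2
    omega

/-- Minimum degree pruning. -/
lemma aux_prune {V : Type*} (k : ℕ) : ∀ (N : ℕ) (E : Finset (V × V)), E.card = N →
    k * ((E.image Prod.fst).card + (E.image Prod.snd).card) < E.card →
    ∃ E' ⊆ E, E'.Nonempty ∧ ∀ e ∈ E', k < (E'.filter fun x => x.1 = e.1).card ∧
      k < (E'.filter fun x => x.2 = e.2).card := by
  classical
  intro N
  induction N using Nat.strong_induction_on with
  | _ N ih =>
  intro E hN hE
  by_cases hall : ∀ e ∈ E, k < (E.filter fun x => x.1 = e.1).card ∧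
      k < (E.filter fun x => x.2 = e.2).card
  · refine ⟨E, subset_rfl, ?_, hall⟩
    rw [← Finset.card_pos]; omega
  · push Not at hall
    obtain ⟨e, he, hbad⟩ := hall
    by_cases h1 : k < (E.filter fun x => x.1 = e.1).card
    · have h2 := hbad h1
      have hc := Finset.card_filter_add_card_filter_not (s := E) (fun x => x.2 = e.2)
      have hpos : 0 < (E.filter fun x => x.2 = e.2).card :=
        Finset.card_pos.2 ⟨e, by simp [he]⟩
      have hs1 : ((E.filter fun x => ¬ x.2 = e.2).image Prod.fst).card ≤ (E.image Prod.fst).card :=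
        Finset.card_le_card (Finset.image_subset_image (Finset.filter_subset _ _))
      have hs2 : ((E.filter fun x => ¬ x.2 = e.2).image Prod.snd).card < (E.image Prod.snd).card := by
        apply Finset.card_lt_card
        refine ⟨Finset.image_subset_image (Finset.filter_subset _ _), fun h => ?_⟩
        have := h (Finset.mem_image_of_mem Prod.snd he)
        simp at this
      obtain ⟨E', hE', h⟩ := ih _ (by omega) (E.filter fun x => ¬ x.2 = e.2) rfl (by nlinarith)
      exact ⟨E', hE'.trans (Finset.filter_subset _ _), h⟩
    · have hc := Finset.card_filter_add_card_filter_not (s := E) (fun x => x.1 = e.1)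
      have hpos : 0 < (E.filter fun x => x.1 = e.1).card :=
        Finset.card_pos.2 ⟨e, by simp [he]⟩
      have hs1 : ((E.filter fun x => ¬ x.1 = e.1).image Prod.snd).card ≤ (E.image Prod.snd).card :=
        Finset.card_le_card (Finset.image_subset_image (Finset.filter_subset _ _))
      have hs2 : ((E.filter fun x => ¬ x.1 = e.1).image Prod.fst).card < (E.image Prod.fst).card := by
        apply Finset.card_lt_card
        refine ⟨Finset.image_subset_image (Finset.filter_subset _ _), fun h => ?_⟩
        have := h (Finset.mem_image_of_mem Prod.fst he)
        simp at this
      obtain ⟨E', hE', h⟩ := ih _ (by omega) (E.filter fun x => ¬ x.1 = e.1) rfl (by nlinarith)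
      exact ⟨E', hE'.trans (Finset.filter_subset _ _), h⟩

lemma aux_nbr_fst {V : Type*} (k : ℕ) (E : Finset (V × V)) (a : V) (X : Finset V)
    (h : k < (E.filter fun x => x.1 = a).card) (hX : X.card ≤ k) :
    ∃ b, (a, b) ∈ E ∧ b ∉ X := by
  classical
  by_contra hcon
  push Not at hcon
  have : (E.filter fun x => x.1 = a).card ≤ X.card := by
    apply Finset.card_le_card_of_injOn Prod.snd
    · rintro ⟨x, y⟩ hx
      simp only [Finset.coe_filter, Set.mem_ofPred_eq] at hx
      obtain ⟨hx, rfl⟩ := hx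
      exact hcon y hx
    · rintro ⟨x, y⟩ hx ⟨x', y'⟩ hx' hh
      simp only [Finset.coe_filter, Set.mem_ofPred_eq] at hx hx' hh
      rw [Prod.mk.injEq]; exact ⟨hx.2.trans hx'.2.symm, hh⟩
  omega

lemma aux_nbr_snd {V : Type*} (k : ℕ) (E : Finset (V × V)) (b : V) (X : Finset V)
    (h : k < (E.filter fun x => x.2 = b).card) (hX : X.card ≤ k) :
    ∃ a, (a, b) ∈ E ∧ a ∉ X := by
  classical
  by_contra hcon
  push Not at hcon
  have : (E.filter fun x => x.2 = b).card ≤ X.card := by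
    apply Finset.card_le_card_of_injOn Prod.fst
    · rintro ⟨x, y⟩ hx
      simp only [Finset.coe_filter, Set.mem_ofPred_eq] at hx
      obtain ⟨hx, rfl⟩ := hx
      exact hcon x hx
    · rintro ⟨x, y⟩ hx ⟨x', y'⟩ hx' hh
      simp only [Finset.coe_filter, Set.mem_ofPred_eq] at hx hx' hh
      rw [Prod.mk.injEq]; exact ⟨hh, hx.2.trans hx'.2.symm⟩
  omega

/-- Greedy path. -/
lemma aux_greedy {V : Type*} (k : ℕ) (E : Finset (V × V))
    (hE : ∀ e ∈ E, k < (E.filter fun x => x.1 = e.1).card ∧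
      k < (E.filter fun x => x.2 = e.2).card) (r s b : V) (hr : (r, b) ∈ E) :
    ∀ q : ℕ, q + 2 ≤ k → ∃ a' b' : ℕ → V, b' 0 = b ∧ (∀ i ≤ q, (a' i, b' i) ∈ E) ∧
      (∀ i < q, (a' i, b' (i + 1)) ∈ E) ∧ (∀ i ≤ q, a' i ≠ r ∧ a' i ≠ s) ∧
      (∀ i ≤ q, ∀ j ≤ q, a' i = a' j → i = j) ∧ (∀ i ≤ q, ∀ j ≤ q, b' i = b' j → i = j) := by
  classical
  intro q
  induction q with
  | zero =>
    intro hk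
    obtain ⟨a, ha, haX⟩ := aux_nbr_snd k E b {r, s} (hE _ hr).2
      ((Finset.card_le_two).trans (by omega))
    simp only [Finset.mem_insert, Finset.mem_singleton, not_or] at haX
    refine ⟨fun _ => a, fun _ => b, rfl, fun _ _ => ha, fun i hi => by omega, fun _ _ => haX,
      fun i hi j hj _ => by omega, fun i hi j hj _ => by omega⟩
  | succ q ih =>
    intro hk
    obtain ⟨a', b', h0, h1, h2, h3, h4, h5⟩ := ih (by omega)
    obtain ⟨bn, hbn, hbX⟩ := aux_nbr_fst k E (a' q) ((Finset.range (q + 1)).image b')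
      (hE _ (h1 q le_rfl)).1 (Finset.card_image_le.trans (by simp; omega))
    obtain ⟨an, han, haX⟩ := aux_nbr_snd k E bn (((Finset.range (q + 1)).image a') ∪ {r, s})
      (hE _ hbn).2 (by
        refine (Finset.card_union_le _ _).trans ?_
        have h1 := Finset.card_image_le (s := Finset.range (q + 1)) (f := a')
        have h2 := Finset.card_le_two (a := r) (b := s)
        simp only [Finset.card_range] at h1
        omega)
    simp only [Finset.mem_union, Finset.mem_image, Finset.mem_range, Finset.mem_insert,
      Finset.mem_singleton, not_or, not_exists, not_and] at haX hbX
    have eA : ∀ i, i ≤ q → Function.update a' (q + 1) an i = a' i := fun i hi =>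
      Function.update_of_ne (by omega) _ _
    have eB : ∀ i, i ≤ q → Function.update b' (q + 1) bn i = b' i := fun i hi =>
      Function.update_of_ne (by omega) _ _
    have eA' : Function.update a' (q + 1) an (q + 1) = an := Function.update_self _ _ _
    have eB' : Function.update b' (q + 1) bn (q + 1) = bn := Function.update_self _ _ _
    refine ⟨Function.update a' (q + 1) an, Function.update b' (q + 1) bn, ?_, ?_, ?_, ?_, ?_, ?_⟩
    · rw [eB 0 (by omega), h0]
    · intro i hi
      rcases Nat.lt_or_ge q i with h | h
      · obtain rfl : i = q + 1 := by omega
        rw [eA', eB']; exact han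
      · rw [eA i h, eB i h]; exact h1 i h
    · intro i hi
      rw [eA i (by omega)]
      rcases Nat.lt_or_ge i q with h | h
      · rw [eB (i + 1) h]; exact h2 i h
      · obtain rfl : i = q := by omega
        rw [eB']; exact hbn
    · intro i hi
      rcases Nat.lt_or_ge q i with h | h
      · obtain rfl : i = q + 1 := by omega
        rw [eA']; exact haX.2
      · rw [eA i h]; exact h3 i h
    · intro i hi j hj hij
      rcases Nat.lt_or_ge q i with h | h <;> rcases Nat.lt_or_ge q j with h' | h'
      · omega
      · obtain rfl : i = q + 1 := by omega
        rw [eA', eA j h'] at hij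
        exact absurd hij.symm (haX.1 j (by omega))
      · obtain rfl : j = q + 1 := by omega
        rw [eA', eA i h] at hij
        exact absurd hij (haX.1 i (by omega))
      · rw [eA i h, eA j h'] at hij; exact h4 i h j h' hij
    · intro i hi j hj hij
      rcases Nat.lt_or_ge q i with h | h <;> rcases Nat.lt_or_ge q j with h' | h'
      · omega
      · obtain rfl : i = q + 1 := by omega
        rw [eB', eB j h'] at hij
        exact absurd hij.symm (hbX j (by omega))
      · obtain rfl : j = q + 1 := by omega
        rw [eB', eB i h] at hij
        exact absurd hij (hbX i (by omega))
      · rw [eB i h, eB j h'] at hij; exact h5 i h j h' hij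

/-- Cycle from a sequence. -/
lemma aux_cycle {V : Type*} (G : SimpleGraph V) (m : ℕ) (hm : 2 ≤ m) (c : ℕ → V)
    (hinj : ∀ i < m, ∀ j < m, c i = c j → i = j)
    (hadj : ∀ i, i + 1 < m → G.Adj (c i) (c (i + 1))) (hlast : G.Adj (c (m - 1)) (c 0)) :
    G.HasCycleOfLength m := by
  have : NeZero m := ⟨by omega⟩
  have : Fact (1 < m) := ⟨by omega⟩
  refine ⟨fun i => c i.val, ?_, ?_⟩
  · intro i j hij
    exact ZMod.val_injective m (hinj _ (ZMod.val_lt i) _ (ZMod.val_lt j) hij)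
  · intro i
    have hi := ZMod.val_lt i
    simp only [ZMod.val_add, ZMod.val_one]
    rcases Nat.lt_or_ge (i.val + 1) m with h | h
    · rw [Nat.mod_eq_of_lt h]; exact hadj _ h
    · have : i.val + 1 = m := by omega
      rw [this, Nat.mod_self]
      have h' : i.val = m - 1 := by omega
      rw [h']; exact hlast

/-- Two branches of the tree plus a path in the bipartite part. -/
lemma aux_branches {V : Type*} (G : SimpleGraph V) (k ℓ : ℕ) (hℓ : ℓ + 1 ≤ k)
    (E : Finset (V × V)) (lev : V → ℕ) (par : V → V)
    (hadj : ∀ e ∈ E, G.Adj e.1 e.2)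
    (hB : ∀ e ∈ E, lev e.2 = ℓ + 1)
    (hlev : ∀ e ∈ E, ∀ i ≤ ℓ, lev (par^[i] e.1) = ℓ - i)
    (hpar : ∀ e ∈ E, ∀ i < ℓ, G.Adj (par^[i] e.1) (par^[i + 1] e.1))
    (h : ℕ) (hh : h + 1 ≤ ℓ) (q : ℕ) (hq : q + 1 + (h + 1) = k) (r b : V) (hr : (r, b) ∈ E)
    (a' b' : ℕ → V) (h0 : b' 0 = b) (h1 : ∀ i ≤ q, (a' i, b' i) ∈ E)
    (h2 : ∀ i < q, (a' i, b' (i + 1)) ∈ E) (h3 : ∀ i ≤ q, a' i ≠ r)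
    (h4 : ∀ i ≤ q, ∀ j ≤ q, a' i = a' j → i = j) (h5 : ∀ i ≤ q, ∀ j ≤ q, b' i = b' j → i = j)
    (htop : par^[h + 1] r = par^[h + 1] (a' q)) (hne : par^[h] r ≠ par^[h] (a' q)) :
    G.HasCycleOfLength (2 * k) := by
  set y : ℕ → V := fun i => if i % 2 = 0 then b' (i / 2) else a' (i / 2) with hy
  set c : ℕ → V := fun i => if i ≤ h then par^[i] r else
    if i ≤ 2 * h + 1 then par^[2 * h + 2 - i] (a' q) else y (2 * k - 1 - i) with hc
  have hE0 := h1 q le_rfl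
  have hne' : ∀ i ≤ h, par^[i] r ≠ par^[i] (a' q) := by
    intro i hi heq
    apply hne
    have : h = (h - i) + i := by omega
    rw [this, Function.iterate_add_apply, Function.iterate_add_apply, heq]
  have c1 : ∀ i, i ≤ h → c i = par^[i] r := fun i hi => by simp [hc, hi]
  have c2 : ∀ i, h < i → i ≤ 2 * h + 1 → c i = par^[2 * h + 2 - i] (a' q) := fun i hi hi' => by
    simp [hc, hi', not_le.2 hi]
  have c3 : ∀ i, 2 * h + 1 < i → c i = y (2 * k - 1 - i) := fun i hi => by
    have : ¬ i ≤ h := by omega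
    simp [hc, not_le.2 hi, this]
  have yE : ∀ i, i ≤ q → y (2 * i) = b' i := fun i _ => by simp [hy]
  have yO : ∀ i, i ≤ q → y (2 * i + 1) = a' i := fun i _ => by
    have e1 : (2 * i + 1) % 2 = 1 := by omega
    have e2 : (2 * i + 1) / 2 = i := by omega
    simp [hy, e1, e2]
  have levA : ∀ e ∈ E, lev e.1 = ℓ := fun e he => by simpa using hlev e he 0 (by omega)
  have ylevE : ∀ i, i ≤ q → lev (y (2 * i)) = ℓ + 1 := fun i hi => by
    rw [yE i hi]; exact hB _ (h1 i hi)
  have ylevO : ∀ i, i ≤ q → lev (y (2 * i + 1)) = ℓ := fun i hi => by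
    rw [yO i hi]; exact levA _ (h1 i hi)
  have yinj : ∀ i < 2 * (q + 1), ∀ j < 2 * (q + 1), y i = y j → i = j := by
    intro i hi j hj hij
    obtain ⟨i', hi' | hi'⟩ := Nat.even_or_odd' i <;> obtain ⟨j', hj' | hj'⟩ := Nat.even_or_odd' j
    · subst hi' hj'
      rw [yE i' (by omega), yE j' (by omega)] at hij
      rw [h5 i' (by omega) j' (by omega) hij]
    · subst hi' hj'
      have e1 := ylevE i' (by omega)
      have e2 := ylevO j' (by omega)
      rw [hij] at e1; omega
    · subst hi' hj'
      have e1 := ylevO i' (by omega)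
      have e2 := ylevE j' (by omega)
      rw [hij] at e1; omega
    · subst hi' hj'
      rw [yO i' (by omega), yO j' (by omega)] at hij
      rw [h4 i' (by omega) j' (by omega) hij]
  have ylev : ∀ i < 2 * (q + 1), ℓ ≤ lev (y i) := by
    intro i hi
    obtain ⟨i', hi' | hi'⟩ := Nat.even_or_odd' i
    · subst hi'; rw [ylevE i' (by omega)]; omega
    · subst hi'; rw [ylevO i' (by omega)]
  have yr : ∀ i < 2 * (q + 1), y i ≠ r := by
    intro i hi heq
    obtain ⟨i', hi' | hi'⟩ := Nat.even_or_odd' i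
    · subst hi'
      have e1 := ylevE i' (by omega)
      rw [heq, levA _ hr] at e1; omega
    · subst hi'
      rw [yO i' (by omega)] at heq
      exact h3 i' (by omega) heq
  have yadj : ∀ i, i + 1 < 2 * (q + 1) → G.Adj (y (i + 1)) (y i) := by
    intro i hi
    obtain ⟨i', hi' | hi'⟩ := Nat.even_or_odd' i
    · subst hi'
      rw [yO i' (by omega), yE i' (by omega)]
      exact hadj _ (h1 i' (by omega))
    · subst hi'
      rw [yO i' (by omega), show 2 * i' + 1 + 1 = 2 * (i' + 1) by ring, yE (i' + 1) (by omega)]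
      exact (hadj _ (h2 i' (by omega))).symm
  have cl1 : ∀ i, i ≤ h → lev (c i) = ℓ - i := fun i hi => by
    rw [c1 i hi]; exact hlev _ hr i (by omega)
  have cl2 : ∀ i, h < i → i ≤ 2 * h + 1 → lev (c i) = ℓ - (2 * h + 2 - i) := fun i hi hi' => by
    rw [c2 i hi hi']; exact hlev _ hE0 _ (by omega)
  have cl3 : ∀ i, 2 * h + 1 < i → i < 2 * k → ℓ ≤ lev (c i) := fun i hi hi' => by
    rw [c3 i hi]; exact ylev _ (by omega)
  have clt : ∀ i < 2 * k, ∀ j < 2 * k, i < j → c i ≠ c j := by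
    intro i hi j hj hlt heq
    have hl := congrArg lev heq
    rcases Nat.lt_or_ge (2 * h + 1) j with hj3 | hj3
    · have l3 := cl3 j hj3 hj
      rcases Nat.lt_or_ge (2 * h + 1) i with hi3 | hi3
      · rw [c3 i hi3, c3 j hj3] at heq
        have := yinj _ (by omega) _ (by omega) heq
        omega
      · rcases Nat.lt_or_ge h i with hi2 | hi2
        · have := cl2 i hi2 hi3
          omega
        · have := cl1 i hi2
          obtain rfl : i = 0 := by omega
          rw [c1 0 hi2, c3 j hj3] at heq
          exact yr _ (by omega) heq.symm
    · rcases Nat.lt_or_ge h j with hj2 | hj2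
      · have e2 := cl2 j hj2 hj3
        rcases Nat.lt_or_ge h i with hi2 | hi2
        · have := cl2 i hi2 (by omega)
          omega
        · have := cl1 i hi2
          have hij : 2 * h + 2 - j = i := by omega
          rw [c1 i hi2, c2 j hj2 hj3, hij] at heq
          exact hne' i hi2 heq
      · have e1 := cl1 i (by omega)
        have e2 := cl1 j hj2
        omega
  refine aux_cycle G (2 * k) (by omega) c ?_ ?_ ?_
  · intro i hi j hj heq
    rcases lt_trichotomy i j with hlt | rfl | hlt
    · exact absurd heq (clt i hi j hj hlt)
    · rfl
    · exact absurd heq.symm (clt j hj i hi hlt)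
  · intro i hi
    rcases Nat.lt_or_ge (2 * h + 1) i with hi3 | hi3
    · rw [c3 i hi3, c3 (i + 1) (by omega)]
      have := yadj (2 * k - 1 - (i + 1)) (by omega)
      rwa [show 2 * k - 1 - (i + 1) + 1 = 2 * k - 1 - i by omega] at this
    · rcases Nat.lt_or_ge h i with hi2 | hi2
      · rw [c2 i hi2 hi3]
        have := hpar _ hE0 (2 * h + 2 - (i + 1)) (by omega)
        rw [show 2 * h + 2 - (i + 1) + 1 = 2 * h + 2 - i by omega] at this
        rcases Nat.lt_or_ge (2 * h + 1) (i + 1) with hi4 | hi4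
        · obtain rfl : i = 2 * h + 1 := by omega
          rw [c3 _ hi4, show 2 * k - 1 - (2 * h + 1 + 1) = 2 * q + 1 by omega, yO q le_rfl]
          rw [show 2 * h + 2 - (2 * h + 1 + 1) = 0 by omega] at this
          exact this.symm
        · rw [c2 (i + 1) (by omega) hi4]; exact this.symm
      · rw [c1 i hi2]
        have := hpar _ hr i (by omega)
        rcases Nat.lt_or_ge i h with hi4 | hi4
        · rw [c1 (i + 1) hi4]; exact this
        · obtain rfl : i = h := by omega
          rw [c2 (i + 1) (by omega) (by omega), show 2 * i + 2 - (i + 1) = i + 1 by omega, ← htop]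
          exact this
  · rw [c3 (2 * k - 1) (by omega), c1 0 (by omega), show 2 * k - 1 - (2 * k - 1) = 2 * 0 by omega,
      yE 0 (by omega), h0]
    exact (hadj _ hr).symm

/-- The tree-plus-dense-bipartite-graph lemma. -/
lemma aux_tree {V : Type*} (G : SimpleGraph V) (k ℓ : ℕ) (hk : 2 ≤ k) (hℓ : ℓ + 1 ≤ k)
    (v : V) (E : Finset (V × V)) (hne : E.Nonempty) (lev : V → ℕ) (par : V → V)
    (hE : ∀ e ∈ E, k < (E.filter fun x => x.1 = e.1).card ∧
      k < (E.filter fun x => x.2 = e.2).card)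
    (hadj : ∀ e ∈ E, G.Adj e.1 e.2)
    (hB : ∀ e ∈ E, lev e.2 = ℓ + 1)
    (hlev : ∀ e ∈ E, ∀ i ≤ ℓ, lev (par^[i] e.1) = ℓ - i)
    (hpar : ∀ e ∈ E, ∀ i < ℓ, G.Adj (par^[i] e.1) (par^[i + 1] e.1))
    (hroot : ∀ e ∈ E, par^[ℓ] e.1 = v) :
    G.HasCycleOfLength (2 * k) := by
  by_contra hcon
  have main : ∀ j ≤ ℓ, ∀ b r s, (r, b) ∈ E → (s, b) ∈ E → par^[ℓ - j] r = par^[ℓ - j] s := by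
    intro j
    induction j with
    | zero =>
      intro _ b r s hr hs
      have h1 := hroot _ hr
      have h2 := hroot _ hs
      simpa using h1.trans h2.symm
    | succ j ih =>
      intro hj b r s hr hs
      have ih := ih (by omega)
      obtain ⟨h, hh⟩ : ∃ h, h = ℓ - (j + 1) := ⟨_, rfl⟩
      rw [show ℓ - j = h + 1 by omega] at ih
      rw [← hh]
      obtain ⟨q, hq⟩ : ∃ q, q + 1 + (h + 1) = k := ⟨k - (h + 1) - 1, by omega⟩
      obtain ⟨a', b', h0, h1, h2, h3, h4, h5⟩ := aux_greedy k E hE r s b hr q (by omega)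
      have chain : ∀ i ≤ q, par^[h + 1] (a' i) = par^[h + 1] (a' 0) := by
        intro i
        induction i with
        | zero => intro _; rfl
        | succ i ihi =>
          intro hi
          rw [← ihi (by omega)]
          exact ih _ _ _ (h1 (i + 1) hi) (h2 i hi)
      have hE0 : (a' 0, b) ∈ E := by rw [← h0]; exact h1 0 (by omega)
      have tr : par^[h + 1] r = par^[h + 1] (a' q) := by
        rw [chain q le_rfl]; exact ih _ _ _ hr hE0
      have ts : par^[h + 1] s = par^[h + 1] (a' q) := by
        rw [chain q le_rfl]; exact ih _ _ _ hs hE0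
      have er : par^[h] r = par^[h] (a' q) := by
        by_contra hne'
        exact hcon (aux_branches G k ℓ hℓ E lev par hadj hB hlev hpar h (by omega) q hq r b hr
          a' b' h0 h1 h2 (fun i hi => (h3 i hi).1) h4 h5 tr hne')
      have es : par^[h] s = par^[h] (a' q) := by
        by_contra hne'
        exact hcon (aux_branches G k ℓ hℓ E lev par hadj hB hlev hpar h (by omega) q hq s b hs
          a' b' h0 h1 h2 (fun i hi => (h3 i hi).2) h4 h5 ts hne')
      rw [er, es]
  obtain ⟨⟨r, b⟩, hr⟩ := hne
  obtain ⟨s, hs, hsX⟩ := aux_nbr_snd k E b {r} (hE _ hr).2 (by simp; omega)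
  have := main ℓ le_rfl b r s hr hs
  simp at this hsX
  exact hsX this.symm

/-- Layered reachability from the root. -/
def auxRch {V : Type*} (G : SimpleGraph V) (lev : V → ℕ) (v : V) : ℕ → V → Prop
  | 0, x => x = v
  | (i + 1), x => lev x = i + 1 ∧ ∃ y, auxRch G lev v i y ∧ G.Adj x y

lemma aux_rch_lev {V : Type*} (G : SimpleGraph V) (lev : V → ℕ) (v : V) (hv : lev v = 0)
    (i : ℕ) (x : V) (h : auxRch G lev v i x) : lev x = i := by
  cases i with
  | zero => rw [auxRch] at h; rw [h, hv]
  | succ i => rw [auxRch] at h; exact h.1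

lemma aux_par {V : Type*} (G : SimpleGraph V) (lev : V → ℕ) (v : V) :
    ∃ par : V → V, ∀ x i, auxRch G lev v (i + 1) x →
      auxRch G lev v i (par x) ∧ G.Adj x (par x) := by
  have : ∀ x, ∃ y, ∀ i, auxRch G lev v (i + 1) x → auxRch G lev v i y ∧ G.Adj x y := by
    intro x
    by_cases h : ∃ i, auxRch G lev v (i + 1) x
    · obtain ⟨i, hi⟩ := h
      have hi' := hi
      rw [auxRch] at hi'
      obtain ⟨h1, y, hy⟩ := hi'
      refine ⟨y, fun j hj => ?_⟩
      have : j = i := by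
        rw [auxRch] at hj
        have := hj.1
        omega
      subst this
      exact hy
    · exact ⟨x, fun i hi => absurd ⟨i, hi⟩ h⟩
  choose par hp using this
  exact ⟨par, hp⟩

lemma aux_num (k t : ℕ) (ht : 2 ≤ t) (htk : t ≤ k) :
    4 * (k : ℝ) ^ 2 * (t : ℝ) ^ t ≤ 11 * (2 * (k : ℝ)) ^ t := by
  have ht0 : (0 : ℝ) < t := by positivity
  have hk2 : (2 : ℝ) ≤ k := by exact_mod_cast ht.trans htk
  have htk' : (t : ℝ) ≤ k := by exact_mod_cast htk
  rcases Nat.lt_or_ge t 3 with h | h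
  · obtain rfl : t = 2 := by omega
    push_cast
    nlinarith
  · have h3 : (3 : ℝ) ≤ t := by exact_mod_cast h
    have hx : (1 : ℝ) ≤ 2 * k / t := by rw [le_div_iff₀ ht0]; linarith
    have hb := one_add_mul_self_le_rpow_one_add (s := 2 * (k : ℝ) / t - 1) (by linarith)
      (p := (t : ℝ) / 3) (by linarith)
    have e1 : 1 + (t : ℝ) / 3 * (2 * (k : ℝ) / t - 1) = 1 + (2 * k - t) / 3 := by
      field_simp
    rw [e1, add_sub_cancel] at hb
    have hb' : 1 + (k : ℝ) / 3 ≤ (2 * (k : ℝ) / t) ^ ((t : ℝ) / 3) := by linarith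
    have hc : (1 + (k : ℝ) / 3) ^ 3 ≤ (2 * (k : ℝ) / t) ^ t := by
      calc (1 + (k : ℝ) / 3) ^ 3 ≤ ((2 * (k : ℝ) / t) ^ ((t : ℝ) / 3)) ^ 3 := by gcongr
        _ = (2 * (k : ℝ) / t) ^ t := by
          rw [← Real.rpow_natCast, ← Real.rpow_mul (by linarith), ← Real.rpow_natCast]
          congr 1
          push_cast
          ring
    rw [div_pow, le_div_iff₀ (by positivity)] at hc
    have hd : 4 * (k : ℝ) ^ 2 ≤ 11 * (1 + (k : ℝ) / 3) ^ 3 := by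
      nlinarith [mul_nonneg (by linarith : (0 : ℝ) ≤ k) (sq_nonneg ((k : ℝ) - 1)), sq_nonneg (k : ℝ)]
    calc 4 * (k : ℝ) ^ 2 * (t : ℝ) ^ t ≤ 11 * (1 + (k : ℝ) / 3) ^ 3 * (t : ℝ) ^ t := by gcongr
      _ ≤ _ := by linarith

/-- If, for some vertex `v` and some `1 ≤ ℓ ≤ k - 1`, the set `W` of vertices of
`R_ℓ(v)` of degree at least `n^{1/k}` satisfies `|W| > 6 ⬝ (2k)^ℓ ⬝ n^{1 - 1/k}`,
then `G` contains a `2k`-cycle. -/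
theorem cycle_of_many_heavy_endpoints {V : Type*} [Fintype V] [DecidableEq V]
    (G : SimpleGraph V) [DecidableRel G.Adj] (k : ℕ) (hk : 2 ≤ k) (v : V)
    (ℓ : ℕ) (hℓ1 : 1 ≤ ℓ) (hℓ2 : ℓ ≤ k - 1)
    (W : Finset V)
    (hW : W = Finset.univ.filter fun u =>
      (∃ p : G.Walk v u, p.IsPath ∧ p.length = ℓ) ∧
      (Fintype.card V : ℝ) ^ ((1 : ℝ) / (k : ℝ)) ≤ (G.degree u : ℝ))
    (h : 6 * (2 * (k : ℝ)) ^ ℓ *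
        (Fintype.card V : ℝ) ^ (1 - (1 : ℝ) / (k : ℝ)) < (W.card : ℝ)) :
    G.HasCycleOfLength (2 * k) := by
  classical
  have hpaths : ∀ w, ∃ g : ℕ → V, w ∈ W → g 0 = v ∧ g ℓ = w ∧
      (∀ i < ℓ, G.Adj (g i) (g (i + 1))) ∧ (∀ i ≤ ℓ, ∀ j ≤ ℓ, g i = g j → i = j) := by
    intro w
    by_cases hw : w ∈ W
    · rw [hW, Finset.mem_filter] at hw
      obtain ⟨-, ⟨p, hp, hl⟩, -⟩ := hw
      refine ⟨p.getVert, fun _ => ⟨p.getVert_zero, ?_, ?_, ?_⟩⟩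
      · rw [← hl]; exact p.getVert_length
      · intro i hi; exact p.adj_getVert_succ (by omega)
      · intro i hi j hj hij
        exact hp.getVert_injOn (by simp; omega) (by simp; omega) hij
    · exact ⟨fun _ => w, fun h => absurd h hw⟩
  choose g hg using hpaths
  have hdeg : ∀ w ∈ W, (Fintype.card V : ℝ) ^ ((1 : ℝ) / (k : ℝ)) ≤ (G.degree w : ℝ) := by
    intro w hw
    rw [hW, Finset.mem_filter] at hw
    exact hw.2.2
  let I : Finset (V × V) := (W ×ˢ Finset.univ).filter fun e =>
    G.Adj e.1 e.2 ∧ ∀ i ≤ ℓ, g e.1 i ≠ e.2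
  have hImem : ∀ e, e ∈ I ↔ e.1 ∈ W ∧ G.Adj e.1 e.2 ∧ ∀ i ≤ ℓ, g e.1 i ≠ e.2 := by
    intro e; simp [I]
  -- lower bound on I
  have hIcard : (W.card : ℝ) * ((Fintype.card V : ℝ) ^ ((1 : ℝ) / (k : ℝ)) - (ℓ + 1)) ≤ I.card := by
    have hfib : I.card = ∑ w ∈ W, (I.filter fun e => e.1 = w).card :=
      Finset.card_eq_sum_card_fiberwise (fun e he => ((hImem e).1 he).1)
    rw [hfib]
    push_cast
    rw [← nsmul_eq_mul]
    apply Finset.card_nsmul_le_sum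
    intro w hw
    have h1 : G.degree w ≤ (I.filter fun e => e.1 = w).card + (ℓ + 1) := by
      have hsub : G.neighborFinset w ⊆
          ((I.filter fun e => e.1 = w).image Prod.snd) ∪ ((Finset.range (ℓ + 1)).image (g w)) := by
        intro u hu
        rw [SimpleGraph.mem_neighborFinset] at hu
        rw [Finset.mem_union]
        by_cases hh : ∀ i ≤ ℓ, g w i ≠ u
        · left
          exact Finset.mem_image.2 ⟨(w, u), Finset.mem_filter.2 ⟨(hImem _).2 ⟨hw, hu, hh⟩, rfl⟩, rfl⟩
        · right
          push Not at hh
          obtain ⟨i, hi, rfl⟩ := hh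
          exact Finset.mem_image_of_mem _ (by simp; omega)
      rw [← SimpleGraph.card_neighborFinset_eq_degree]
      refine (Finset.card_le_card hsub).trans ((Finset.card_union_le _ _).trans ?_)
      have e1 := Finset.card_image_le (s := I.filter fun e => e.1 = w) (f := Prod.snd)
      have e2 := Finset.card_image_le (s := Finset.range (ℓ + 1)) (f := g w)
      rw [Finset.card_range] at e2
      omega
    have h2 := hdeg w hw
    have h3 : (G.degree w : ℝ) ≤ ((I.filter fun e => e.1 = w).card : ℝ) + (ℓ + 1) := by
      exact_mod_cast h1
    linarith
  -- numerics
  have hIbig : (ℓ + 1) ^ (ℓ + 1) * (k * Fintype.card V) < I.card := by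
    have hn : (0 : ℝ) < Fintype.card V := by
      exact_mod_cast Fintype.card_pos_iff.2 ⟨v⟩
    set n : ℝ := (Fintype.card V : ℝ) with hndef
    set d : ℝ := n ^ ((1 : ℝ) / (k : ℝ)) with hd
    set D : ℝ := n ^ (1 - (1 : ℝ) / (k : ℝ)) with hD
    have hdpos : 0 < d := Real.rpow_pos_of_pos hn _
    have hDpos : 0 < D := Real.rpow_pos_of_pos hn _
    have hDd : D * d = n := by
      rw [hD, hd, ← Real.rpow_add hn]; simp
    have hWn : (W.card : ℝ) ≤ n := by
      rw [hndef]; exact_mod_cast Finset.card_le_univ W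
    have hk' : (2 : ℝ) ≤ k := by exact_mod_cast hk
    have hKpos : (0 : ℝ) < (2 * (k : ℝ)) ^ ℓ := by positivity
    have hK1 : 2 * (k : ℝ) ≤ (2 * (k : ℝ)) ^ ℓ := by
      calc 2 * (k : ℝ) = (2 * (k : ℝ)) ^ 1 := (pow_one _).symm
        _ ≤ _ := pow_le_pow_right₀ (by linarith) hℓ1
    have hdbig : 6 * (2 * (k : ℝ)) ^ ℓ < d := by
      have : 6 * (2 * (k : ℝ)) ^ ℓ * D < d * D := by rw [mul_comm d, hDd]; linarith
      exact lt_of_mul_lt_mul_right this hDpos.le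
    have hlk : (ℓ : ℝ) + 1 ≤ k := by
      have : ℓ + 1 ≤ k := by omega
      exact_mod_cast this
    have h12 : 11 / 12 * d ≤ d - (ℓ + 1) := by linarith
    have hnum := aux_num k (ℓ + 1) (by omega) (by omega)
    rw [pow_succ (2 * (k : ℝ))] at hnum
    push_cast at hnum
    have hnum' : k * ((ℓ : ℝ) + 1) ^ (ℓ + 1) ≤ 11 / 2 * (2 * (k : ℝ)) ^ ℓ := by
      have hkp : (0 : ℝ) < 4 * k := by linarith
      apply le_of_mul_le_mul_left _ hkp
      nlinarith
    have hfin : ((ℓ : ℝ) + 1) ^ (ℓ + 1) * (k * n) < I.card := by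
      calc ((ℓ : ℝ) + 1) ^ (ℓ + 1) * (k * n) = (k * ((ℓ : ℝ) + 1) ^ (ℓ + 1)) * n := by ring
        _ ≤ (11 / 2 * (2 * (k : ℝ)) ^ ℓ) * n := by gcongr
        _ = (6 * (2 * (k : ℝ)) ^ ℓ * D) * (11 / 12 * d) := by rw [← hDd]; ring
        _ < W.card * (11 / 12 * d) := by gcongr
        _ ≤ W.card * (d - (ℓ + 1)) := by gcongr
        _ ≤ _ := hIcard
    rw [hndef] at hfin
    exact_mod_cast hfin
  -- colouring
  let φ : V × V → Fin (ℓ + 1) → V := fun e i => if i.val = 0 then e.2 else g e.1 i.val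
  have hφ : ∀ e ∈ I, Function.Injective (φ e) := by
    intro e he i j hij
    obtain ⟨hw, -, hu⟩ := (hImem e).1 he
    have hi := i.isLt
    have hj := j.isLt
    simp only [φ] at hij
    apply Fin.ext
    split_ifs at hij with h1 h2 h2
    · omega
    · exact absurd hij.symm (hu _ (by omega))
    · exact absurd hij (hu _ (by omega))
    · exact (hg e.1 hw).2.2.2 _ (by omega) _ (by omega) hij
  obtain ⟨χ, hχ⟩ := aux_coloring (ℓ + 1) (by omega) I φ hφ
  set E : Finset (V × V) := I.filter fun e => ∀ j, χ (φ e j) = j with hEdef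
  have hEbig : k * Fintype.card V < E.card := by
    have := hIbig.trans_le hχ
    exact lt_of_mul_lt_mul_left this (Nat.zero_le _)
  let lev : V → ℕ := fun x => if x = v then 0 else if (χ x).val = 0 then ℓ + 1 else (χ x).val
  have hlevv : lev v = 0 := by simp [lev]
  have hEI : ∀ e ∈ E, e ∈ I := fun e he => (Finset.mem_filter.1 he).1
  have hEB : ∀ e ∈ E, lev e.2 = ℓ + 1 := by
    intro e he
    obtain ⟨hw, hadj, hu⟩ := (hImem e).1 (hEI e he)
    have h1 := (Finset.mem_filter.1 he).2 ⟨0, by omega⟩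
    simp only [φ, if_true] at h1
    have h2 : e.2 ≠ v := by
      have := hu 0 (by omega)
      rw [(hg e.1 hw).1] at this
      exact this.symm
    simp [lev, h2, h1]
  have hElev : ∀ e ∈ E, ∀ i, 1 ≤ i → i ≤ ℓ → lev (g e.1 i) = i := by
    intro e he i hi1 hi2
    obtain ⟨hw, hadj, hu⟩ := (hImem e).1 (hEI e he)
    have h1 := (Finset.mem_filter.1 he).2 ⟨i, by omega⟩
    have hi0 : i ≠ 0 := by omega
    simp only [φ, hi0, if_false] at h1
    have h2 : g e.1 i ≠ v := by
      intro h2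
      rw [← (hg e.1 hw).1] at h2
      exact hi0 ((hg e.1 hw).2.2.2 _ hi2 _ (by omega) h2)
    simp [lev, h2, h1, hi0]
  have hErch : ∀ e ∈ E, auxRch G lev v ℓ e.1 := by
    intro e he
    obtain ⟨hw, hadj, hu⟩ := (hImem e).1 (hEI e he)
    obtain ⟨g0, gl, gadj, -⟩ := hg e.1 hw
    have : ∀ i ≤ ℓ, auxRch G lev v i (g e.1 i) := by
      intro i
      induction i with
      | zero => intro _; rw [auxRch]; exact g0
      | succ i ih =>
        intro hi
        rw [auxRch]
        exact ⟨hElev e he _ (by omega) hi, _, ih (by omega), (gadj i hi).symm⟩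
    have := this ℓ le_rfl
    rwa [gl] at this
  have hcards : (E.image Prod.fst).card + (E.image Prod.snd).card ≤ Fintype.card V := by
    rw [← Finset.card_union_of_disjoint]
    · exact Finset.card_le_univ _
    · rw [Finset.disjoint_left]
      intro x hx hx'
      obtain ⟨e, he, rfl⟩ := Finset.mem_image.1 hx
      obtain ⟨e', he', hee⟩ := Finset.mem_image.1 hx'
      have h1 := aux_rch_lev G lev v hlevv _ _ (hErch e he)
      have h2 := hEB e' he'
      rw [hee] at h2
      omega
  obtain ⟨E', hsub, hne, hmin⟩ := aux_prune k _ E rfl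
    (lt_of_le_of_lt (Nat.mul_le_mul_left k (by convert hcards)) hEbig)
  obtain ⟨par, hpar⟩ := aux_par G lev v
  have hit : ∀ e ∈ E', ∀ i ≤ ℓ, auxRch G lev v (ℓ - i) (par^[i] e.1) := by
    intro e he i
    induction i with
    | zero => intro _; exact hErch e (hsub he)
    | succ i ih =>
      intro hi
      have h1 := ih (by omega)
      rw [show ℓ - i = ℓ - (i + 1) + 1 by omega] at h1
      rw [Function.iterate_succ_apply']
      exact (hpar _ _ h1).1
  refine aux_tree G k ℓ hk (by omega) v E' hne lev par hmin ?_ ?_ ?_ ?_ ?_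
  · intro e he; exact ((hImem e).1 (hEI e (hsub he))).2.1
  · intro e he; exact hEB e (hsub he)
  · intro e he i hi; exact aux_rch_lev G lev v hlevv _ _ (hit e he i hi)
  · intro e he i hi
    have h1 := hit e he i hi.le
    rw [show ℓ - i = ℓ - (i + 1) + 1 by omega] at h1
    rw [Function.iterate_succ_apply']
    exact (hpar _ _ h1).2
  · intro e he
    have h1 := hit e he ℓ le_rfl
    rw [Nat.sub_self, auxRch] at h1
    exact h1
end
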